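/- arXiv:2006.04710 — 2 statements merged into one kernel-verified Lean document; each statement's English description precedes it below -/
import Mathlib

section
/- The key softmax-variance inequality: Σ_{j=1}^N P_{ij} ‖y_j − ȳ‖₂² ≤ Σ_{j=1}^N P_{ij} ‖y_j − y_i‖₂² ≤ c. In particular, the trace of the covariance matrix of the discrete distribution on {y_1,…,y_N} with probabilities P_{i1},…,P_{iN} is at most c. -/
open BigOperators

/-- A weighted sum of squared deviations is smallest about the weighted mean. -/
theorem sum_mul_sub_weightedMean_sq_le {ι : Type*} (s : Finset ι) (w x : ι → ℝ)
    (hw : ∑ j ∈ s, w j = 1) (t : ℝ) :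
    ∑ j ∈ s, w j * (x j - ∑ k ∈ s, w k * x k) ^ 2 ≤ ∑ j ∈ s, w j * (x j - t) ^ 2 := by
  have expand (u : ℝ) : ∑ j ∈ s, w j * (x j - u) ^ 2 =
      ∑ j ∈ s, w j * x j ^ 2 - 2 * u * ∑ j ∈ s, w j * x j + u ^ 2 := by
    calc ∑ j ∈ s, w j * (x j - u) ^ 2
        = ∑ j ∈ s, (w j * x j ^ 2 - 2 * u * (w j * x j) + u ^ 2 * w j) :=
          Finset.sum_congr rfl fun j _ => by ring
      _ = _ := by
          rw [Finset.sum_add_distrib, Finset.sum_sub_distrib, ← Finset.mul_sum,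
            ← Finset.mul_sum, hw, mul_one]
  rw [expand, expand]
  nlinarith [sq_nonneg (t - ∑ k ∈ s, w k * x k)]

/-- The tangent-line bound for `x ↦ (x - c) * exp (-x)`, whose maximum is at `x = c + 1`. -/
theorem sub_mul_exp_neg_le (c x : ℝ) :
    (x - c) * Real.exp (-x) ≤ Real.exp (-(c + 1)) := by
  have h : x - c ≤ Real.exp (x - (c + 1)) := by
    linarith [Real.add_one_le_exp (x - (c + 1))]
  calc (x - c) * Real.exp (-x) ≤ Real.exp (x - (c + 1)) * Real.exp (-x) := by gcongr
    _ = Real.exp (-(c + 1)) := by rw [← Real.exp_add]; ring_nf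

/-- If one of the energies `s j` vanishes, their Gibbs sum is at most `c` times the partition
function, where `c * exp (c + 1)` is the number of remaining energies. -/
theorem sum_exp_neg_mul_le {ι : Type*} [Fintype ι] (s : ι → ℝ) (i : ι) (hi : s i = 0)
    (c : ℝ) (hc : c * Real.exp (c + 1) = (Fintype.card ι : ℝ) - 1) :
    ∑ j, Real.exp (-s j) * s j ≤ c * ∑ j, Real.exp (-s j) := by
  classical
  have hsum : ∑ j ∈ Finset.univ.erase i, (s j - c) * Real.exp (-s j) ≤ c := by
    calc ∑ j ∈ Finset.univ.erase i, (s j - c) * Real.exp (-s j)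
        ≤ ∑ _j ∈ Finset.univ.erase i, Real.exp (-(c + 1)) :=
          Finset.sum_le_sum fun j _ => sub_mul_exp_neg_le c (s j)
      _ = ((Fintype.card ι : ℝ) - 1) * Real.exp (-(c + 1)) := by
          rw [Finset.sum_const, nsmul_eq_mul, Finset.cast_card_erase_of_mem (Finset.mem_univ i),
            Finset.card_univ]
      _ = c := by rw [← hc, mul_assoc, ← Real.exp_add, add_neg_cancel, Real.exp_zero, mul_one]
  have hsplit := Finset.add_sum_erase Finset.univ (fun j => (s j - c) * Real.exp (-s j))
    (Finset.mem_univ i)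
  have hdiff : ∑ j, (s j - c) * Real.exp (-s j) =
      ∑ j, Real.exp (-s j) * s j - c * ∑ j, Real.exp (-s j) := by
    rw [Finset.mul_sum, ← Finset.sum_sub_distrib]
    exact Finset.sum_congr rfl fun j _ => by ring
  simp only [hi, neg_zero, Real.exp_zero] at hsplit
  linarith

/-- The key softmax-variance inequality:
`∑ⱼ Pⱼ‖yⱼ − ȳ‖₂² ≤ ∑ⱼ Pⱼ‖yⱼ − yᵢ‖₂² ≤ c` where `Pⱼ` are the softmax weights
`Pⱼ ∝ exp(−‖yⱼ − yᵢ‖₂²)`, `ȳ = ∑ₖ Pₖ yₖ`, and `c·exp(c+1) = N − 1`. -/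
theorem softmax_variance_key_inequality
    (N d : ℕ) (hN : 1 ≤ N) (hd : 1 ≤ d)
    (y : Fin N → Fin d → ℝ) (i : Fin N)
    (P : Fin N → ℝ)
    (hP : ∀ j, P j = Real.exp (-(∑ m, (y j m - y i m) ^ 2)) /
      ∑ k, Real.exp (-(∑ m, (y k m - y i m) ^ 2)))
    (ybar : Fin d → ℝ) (hybar : ∀ m, ybar m = ∑ k, P k * y k m)
    (c : ℝ) (hc0 : 0 ≤ c) (hc : c * Real.exp (c + 1) = (N : ℝ) - 1) :
    (∑ j, P j * ∑ m, (y j m - ybar m) ^ 2) ≤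
      (∑ j, P j * ∑ m, (y j m - y i m) ^ 2) ∧
    (∑ j, P j * ∑ m, (y j m - y i m) ^ 2) ≤ c := by
  have hZ : 0 < ∑ k, Real.exp (-(∑ m, (y k m - y i m) ^ 2)) :=
    Finset.sum_pos (fun _ _ => Real.exp_pos _) ⟨i, Finset.mem_univ i⟩
  refine ⟨?_, ?_⟩
  · have hP1 : ∑ j, P j = 1 := by
      simp only [hP]
      rw [← Finset.sum_div, div_self hZ.ne']
    simp only [Finset.mul_sum]
    rw [Finset.sum_comm, Finset.sum_comm (f := fun j m => P j * (y j m - y i m) ^ 2)]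
    refine Finset.sum_le_sum fun m _ => ?_
    rw [hybar m]
    exact sum_mul_sub_weightedMean_sq_le Finset.univ P (fun j => y j m) hP1 (y i m)
  · simp only [hP, div_mul_eq_mul_div]
    rw [← Finset.sum_div, div_le_iff₀ hZ]
    exact sum_exp_neg_mul_le (fun j => ∑ m, (y j m - y i m) ^ 2) i (by simp) c (by simpa using hc)
end

section
/- The ∞-operator norm of the softmax-attention covariance matrix is at most √d · c. Precisely, let M = Σ_{j=1}^N P_{ij} (y_j − ȳ)(y_j − ȳ)⊤ ∈ ℝ^{d×d} be the covariance matrix of the discrete distribution on {y_1,…,y_N} with probabilities P_{i1},…,P_{iN}. Then max_{1 ≤ l ≤ d} Σ_{m=1}^d |M_{lm}| ≤ √d · c. -/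
open Matrix BigOperators

/-- The operator norm induced by the vector ℓ∞ norm: the maximum absolute row sum. -/
noncomputable def maxRowSum {m n : Type*} [Fintype m] [Fintype n] (M : Matrix m n ℝ) : ℝ :=
  ⨆ i, ∑ j, |M i j|

/-- The mean of a weighted family minimises the weighted sum of squared deviations. -/
theorem sum_mul_sq_sub_mean_le {ι : Type*} [Fintype ι] {w x : ι → ℝ}
    (hw : ∑ j, w j = 1) (a : ℝ) :
    ∑ j, w j * (x j - ∑ k, w k * x k) ^ 2 ≤ ∑ j, w j * (x j - a) ^ 2 := by
  set b := ∑ k, w k * x k with hb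
  have key : ∀ r : ℝ, ∑ j, w j * (x j - r) ^ 2 = ∑ j, w j * x j ^ 2 - 2 * r * b + r ^ 2 := by
    intro r
    calc ∑ j, w j * (x j - r) ^ 2
        = ∑ j, (w j * x j ^ 2 - 2 * r * (w j * x j) + r ^ 2 * w j) :=
          Finset.sum_congr rfl fun j _ => by ring
      _ = ∑ j, w j * x j ^ 2 - 2 * r * b + r ^ 2 := by
          rw [Finset.sum_add_distrib, Finset.sum_sub_distrib, ← Finset.mul_sum,
            ← Finset.mul_sum, hw, mul_one]
  rw [key, key]
  nlinarith [sq_nonneg (b - a)]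

/-- The mean of `t` under the Gibbs weights `exp (-t)` is at most `c` when `t` vanishes somewhere
and `c * exp (c + 1)` is the number of remaining indices. -/
theorem sum_mul_exp_neg_le {ι : Type*} [Fintype ι] {t : ι → ℝ} {i : ι} (hi : t i = 0)
    {c : ℝ} (hc : c * Real.exp (c + 1) = (Fintype.card ι : ℝ) - 1) :
    ∑ j, t j * Real.exp (-t j) ≤ c * ∑ j, Real.exp (-t j) := by
  classical
  have hpoint : ∀ x : ℝ, (x - c) * Real.exp (-x) ≤ Real.exp (-(c + 1)) := by
    intro x
    have h := Real.add_one_le_exp (x - (c + 1))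
    calc (x - c) * Real.exp (-x) ≤ Real.exp (x - (c + 1)) * Real.exp (-x) := by
          gcongr
          linarith
      _ = Real.exp (-(c + 1)) := by
          rw [← Real.exp_add]
          ring_nf
  have hcard : ((Finset.univ.erase i).card : ℝ) = (Fintype.card ι : ℝ) - 1 := by
    rw [Finset.cast_card_erase_of_mem (Finset.mem_univ i), Finset.card_univ]
  have hrest : ∑ j ∈ Finset.univ.erase i, (t j - c) * Real.exp (-t j) ≤ c := by
    calc ∑ j ∈ Finset.univ.erase i, (t j - c) * Real.exp (-t j)
        ≤ ∑ j ∈ Finset.univ.erase i, Real.exp (-(c + 1)) :=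
          Finset.sum_le_sum fun j _ => hpoint (t j)
      _ = c := by
          rw [Finset.sum_const, nsmul_eq_mul, hcard, ← hc, mul_assoc, ← Real.exp_add]
          simp
  have hsplit := Finset.add_sum_erase Finset.univ (fun j => (t j - c) * Real.exp (-t j))
    (Finset.mem_univ i)
  simp only [hi, neg_zero, Real.exp_zero, sub_mul, Finset.sum_sub_distrib,
    ← Finset.mul_sum] at hsplit hrest
  linarith

/-- The `ℓ¹` norm of a row of the rank-one matrix `z zᵀ` is at most `√d ‖z‖₂²`. -/
theorem abs_mul_sum_abs_le {ι : Type*} [Fintype ι] (z : ι → ℝ) (l : ι) :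
    |z l| * ∑ m, |z m| ≤ Real.sqrt (Fintype.card ι) * ∑ m, z m ^ 2 := by
  have hq : 0 ≤ ∑ m, z m ^ 2 := Finset.sum_nonneg fun m _ => sq_nonneg _
  have hl : |z l| ≤ Real.sqrt (∑ m, z m ^ 2) :=
    Real.abs_le_sqrt (Finset.single_le_sum (f := fun m => z m ^ 2)
      (fun m _ => sq_nonneg _) (Finset.mem_univ l))
  have hs : ∑ m, |z m| ≤ Real.sqrt (Fintype.card ι) * Real.sqrt (∑ m, z m ^ 2) := by
    rw [← Real.sqrt_mul (Nat.cast_nonneg _)]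
    apply Real.le_sqrt_of_sq_le
    simpa using sq_sum_le_card_mul_sum_sq (s := Finset.univ) (f := fun m => |z m|)
  calc |z l| * ∑ m, |z m|
      ≤ Real.sqrt (∑ m, z m ^ 2) *
          (Real.sqrt (Fintype.card ι) * Real.sqrt (∑ m, z m ^ 2)) := by gcongr
    _ = Real.sqrt (Fintype.card ι) *
          (Real.sqrt (∑ m, z m ^ 2) * Real.sqrt (∑ m, z m ^ 2)) := by ring
    _ = Real.sqrt (Fintype.card ι) * ∑ m, z m ^ 2 := by rw [Real.mul_self_sqrt hq]

/-- The ∞-operator norm of the softmax-attention covariance matrix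
`M = ∑ⱼ Pⱼ (yⱼ − ȳ)(yⱼ − ȳ)ᵀ` is at most `√d · c`, where `Pⱼ` are the softmax
weights `Pⱼ ∝ exp(−‖yⱼ − yᵢ‖₂²)`, `ȳ = ∑ₖ Pₖ yₖ`, and `c·exp(c+1) = N − 1`. -/
theorem softmax_cov_maxRowSum_le
    (N d : ℕ) (hN : 1 ≤ N) (hd : 1 ≤ d)
    (y : Fin N → Fin d → ℝ) (i : Fin N)
    (P : Fin N → ℝ)
    (hP : ∀ j, P j = Real.exp (-(∑ m, (y j m - y i m) ^ 2)) /
      ∑ k, Real.exp (-(∑ m, (y k m - y i m) ^ 2)))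
    (ybar : Fin d → ℝ) (hybar : ∀ m, ybar m = ∑ k, P k * y k m)
    (M : Matrix (Fin d) (Fin d) ℝ)
    (hM : ∀ l m, M l m = ∑ j, P j * (y j l - ybar l) * (y j m - ybar m))
    (c : ℝ) (hc0 : 0 ≤ c) (hc : c * Real.exp (c + 1) = (N : ℝ) - 1) :
    maxRowSum M ≤ Real.sqrt d * c := by
  have hZ : 0 < ∑ k, Real.exp (-(∑ m, (y k m - y i m) ^ 2)) :=
    Finset.sum_pos (fun k _ => Real.exp_pos _) ⟨i, Finset.mem_univ i⟩
  have hP0 : ∀ j, 0 ≤ P j := fun j => by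
    rw [hP]
    exact div_nonneg (Real.exp_pos _).le hZ.le
  have hP1 : ∑ j, P j = 1 := by
    simp only [hP]
    rw [← Finset.sum_div, div_self hZ.ne']
  have hmean : ∑ j, P j * ∑ m, (y j m - y i m) ^ 2 ≤ c := by
    have h := sum_mul_exp_neg_le (t := fun j => ∑ m, (y j m - y i m) ^ 2) (i := i)
      (by simp) (c := c) (by simpa using hc)
    rw [← div_le_iff₀ hZ, Finset.sum_div] at h
    refine le_of_eq_of_le (Finset.sum_congr rfl fun j _ => ?_) h
    rw [hP]
    ring
  have hvar : ∑ j, P j * ∑ m, (y j m - ybar m) ^ 2 ≤ c := by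
    refine le_trans ?_ hmean
    simp only [Finset.mul_sum]
    rw [Finset.sum_comm, Finset.sum_comm (f := fun j m => P j * (y j m - y i m) ^ 2)]
    refine Finset.sum_le_sum fun m _ => ?_
    rw [hybar m]
    exact sum_mul_sq_sub_mean_le hP1 (y i m)
  have : Nonempty (Fin d) := ⟨⟨0, hd⟩⟩
  refine ciSup_le fun l => ?_
  calc ∑ m, |M l m|
      ≤ ∑ m, ∑ j, P j * (|y j l - ybar l| * |y j m - ybar m|) := by
        refine Finset.sum_le_sum fun m _ => ?_
        rw [hM]
        refine (Finset.abs_sum_le_sum_abs _ _).trans_eq (Finset.sum_congr rfl fun j _ => ?_)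
        rw [abs_mul, abs_mul, abs_of_nonneg (hP0 j), mul_assoc]
    _ = ∑ j, P j * (|y j l - ybar l| * ∑ m, |y j m - ybar m|) := by
        rw [Finset.sum_comm]
        simp only [Finset.mul_sum]
    _ ≤ ∑ j, P j * (Real.sqrt d * ∑ m, (y j m - ybar m) ^ 2) := by
        refine Finset.sum_le_sum fun j _ => mul_le_mul_of_nonneg_left ?_ (hP0 j)
        simpa using abs_mul_sum_abs_le (fun m => y j m - ybar m) l
    _ = Real.sqrt d * ∑ j, P j * ∑ m, (y j m - ybar m) ^ 2 := by
        rw [Finset.mul_sum]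
        exact Finset.sum_congr rfl fun j _ => by ring
    _ ≤ Real.sqrt d * c := mul_le_mul_of_nonneg_left hvar (Real.sqrt_nonneg _)
end
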